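/- For every real c > 1 there exist constants c₀ > 1 and ε₀ > 0 such that for every ε ∈ (0, ε₀) the following holds: if for every positive integer n there exists an f(l)-distance ε-synchronization string of length n over a finite alphabet Σ, where f(l) = ⌊c^l⌋, then |Σ| ≥ c₀^{1/ε}; that is, the alphabet size must be at least exponentially large in 1/ε. -/

import Mathlib

/-- Length of a longest common subsequence of `a` and `b`. -/
def lcsLen {α : Type*} [DecidableEq α] (a b : List α) : ℕ :=
  ((a.sublists.filter (fun c => decide (c.Sublist b))).map List.length).foldr max 0

/-- Edit distance: the minimum number of single-symbol insertions and deletions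
transforming one string into the other, via `ED a b = |a| + |b| - 2·LCS(a,b)`. -/
def ED {α : Type*} [DecidableEq α] (a b : List α) : ℕ :=
  a.length + b.length - 2 * lcsLen a b

/-- `substr S i j` is the substring `S[i,j)` from 1-based position `i` (inclusive)
to position `j` (exclusive). -/
def substr {α : Type*} (S : List α) (i j : ℕ) : List α :=
  (S.drop (i - 1)).take (j - i)


/-- `S` is an `f(l)`-distance `ε`-synchronization string: for all positions
`1 ≤ i < j ≤ i' < j' ≤ |S| + 1` with `i' - j ≤ f(l)` where `l = (j-i)+(j'-i')`,
`ED(S[i,j), S[i',j')) > (1-ε)·l`. -/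
def FDistSync {α : Type*} [DecidableEq α] (f : ℕ → ℕ) (ε : ℝ) (S : List α) : Prop :=
  ∀ i j i' j' : ℕ, 1 ≤ i → i < j → j ≤ i' → i' < j' → j' ≤ S.length + 1 →
    i' - j ≤ f ((j - i) + (j' - i')) →
    (ED (substr S i j) (substr S i' j') : ℝ) >
      (1 - ε) * (((j - i) + (j' - i') : ℕ) : ℝ)


theorem le_foldr_max_of_mem {L : List ℕ} {x : ℕ} (hx : x ∈ L) : x ≤ L.foldr max 0 := by
  induction L with
  | nil => simp at hx
  | cons y L ih =>
    rw [List.foldr_cons]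
    rcases List.mem_cons.1 hx with rfl | h
    · exact le_max_left _ _
    · exact (ih h).trans (le_max_right _ _)

theorem length_le_lcsLen {α : Type*} [DecidableEq α] {a b w : List α}
    (ha : w.Sublist a) (hb : w.Sublist b) : w.length ≤ lcsLen a b :=
  le_foldr_max_of_mem <| List.mem_map_of_mem <|
    List.mem_filter.2 ⟨List.mem_sublists.2 ha, decide_eq_true hb⟩

theorem ED_le_of_mem {α : Type*} [DecidableEq α] {a b : List α} {x : α}
    (ha : x ∈ a) (hb : x ∈ b) : ED a b ≤ a.length + b.length - 2 := by
  have h : [x].length ≤ lcsLen a b :=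
    length_le_lcsLen (List.singleton_sublist.2 ha) (List.singleton_sublist.2 hb)
  rw [List.length_singleton] at h
  unfold ED
  omega

theorem getElem_mem_substr {α : Type*} (S : List α) {i j m : ℕ} (hm : m < S.length)
    (him : i ≤ m + 1) (hi : 1 ≤ i) (hmj : m + 1 < j) : S[m] ∈ substr S i j := by
  refine List.mem_iff_getElem.2 ⟨m - (i - 1), ?_, ?_⟩
  · simp only [substr, List.length_take, List.length_drop]
    omega
  · simp only [substr, List.getElem_take, List.getElem_drop]
    congr 1
    omega

theorem length_substr_le {α : Type*} (S : List α) (i j : ℕ) :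
    (substr S i j).length ≤ j - i :=
  List.length_take_le _ _

/-- Two windows of length `k ≤ 1/ε`, one ending and one starting at equal symbols, would violate
the synchronization property; hence symbols that are close together and at distance at least `k`
from both ends are distinct. -/
theorem FDistSync.getElem_ne {α : Type*} [DecidableEq α] {f : ℕ → ℕ} {ε : ℝ} {S : List α}
    (hS : FDistSync f ε S) {k p q : ℕ} (hk : 1 ≤ k) (hkε : ε * k ≤ 1) (hkp : k ≤ p + 1)
    (hpq : p < q) (hq : q + k ≤ S.length) (hd : q - p - 1 ≤ f (2 * k)) :
    S[p] ≠ S[q] := by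
  intro heq
  have hl : (p + 2 - (p + 2 - k)) + (q + 1 + k - (q + 1)) = 2 * k := by omega
  have h := hS (p + 2 - k) (p + 2) (q + 1) (q + 1 + k) (by omega) (by omega) (by omega)
    (by omega) (by omega) (by rw [hl]; exact le_trans (by omega) hd)
  rw [hl] at h
  have hED := ED_le_of_mem
    (getElem_mem_substr S (i := p + 2 - k) (j := p + 2) (m := p)
      (by omega) (by omega) (by omega) (by omega))
    (heq ▸ getElem_mem_substr S (i := q + 1) (j := q + 1 + k) (m := q)
      (by omega) (by omega) (by omega) (by omega))
  have h₁ := length_substr_le S (p + 2 - k) (p + 2)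
  have h₂ := length_substr_le S (q + 1) (q + 1 + k)
  have hle : ED (substr S (p + 2 - k) (p + 2)) (substr S (q + 1) (q + 1 + k)) + 2 ≤ 2 * k := by
    omega
  have hle' : (ED (substr S (p + 2 - k) (p + 2)) (substr S (q + 1) (q + 1 + k)) : ℝ) + 2
      ≤ 2 * k := by exact_mod_cast hle
  push_cast at h
  nlinarith

theorem FDistSync.lt_card {α : Type*} [Fintype α] [DecidableEq α] {f : ℕ → ℕ} {ε : ℝ}
    {S : List α} (hS : FDistSync f ε S) {k : ℕ} (hk : 1 ≤ k) (hkε : ε * k ≤ 1)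
    (hlen : S.length = 2 * k + (f (2 * k) + 1)) : f (2 * k) < Fintype.card α := by
  have hne : ∀ u v : Fin (f (2 * k) + 1), u < v → S[k + u.1] ≠ S[k + v.1] := fun u v huv =>
    hS.getElem_ne hk hkε (by omega) (by omega) (by omega) (by omega)
  have hinj : Function.Injective fun u : Fin (f (2 * k) + 1) => S[k + u.1] := by
    intro u v huv
    rcases lt_trichotomy u v with h | h | h
    · exact absurd huv (hne u v h)
    · exact h
    · exact absurd huv.symm (hne v u h)
  simpa using Fintype.card_le_of_injective _ hinj

/-- For every real `c > 1` there are constants `c₀ > 1` and `ε₀ > 0` such that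
for every `ε ∈ (0, ε₀)`: if `⌊c^l⌋`-distance `ε`-synchronization strings of every
length exist over a finite alphabet `Σ`, then `|Σ| ≥ c₀^(1/ε)` — the alphabet
must be exponentially large in `1/ε`. -/
theorem stmt_16 (c : ℝ) (hc : 1 < c) :
    ∃ c₀ ε₀ : ℝ, 1 < c₀ ∧ 0 < ε₀ ∧ ∀ ε : ℝ, 0 < ε → ε < ε₀ →
      ∀ (α : Type) [Fintype α] [DecidableEq α],
        (∀ n : ℕ, 0 < n → ∃ S : List α, S.length = n ∧
          FDistSync (fun l => ⌊c ^ l⌋₊) ε S) →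
        (Fintype.card α : ℝ) ≥ c₀ ^ (1 / ε) := by
  refine ⟨c, 1, hc, one_pos, fun ε hε hε1 α _ _ hex => ?_⟩
  have hx : 1 < 1 / ε := (one_lt_div hε).2 hε1
  set k := ⌊1 / ε⌋₊ with hkdef
  have hk : 1 ≤ k := Nat.one_le_floor_iff (1 / ε) |>.2 hx.le
  have hkε : ε * k ≤ 1 := by
    have h := Nat.floor_le (zero_le_one.trans hx.le)
    rwa [le_div_iff₀' hε] at h
  have hk2 : 1 / ε ≤ ((2 * k : ℕ) : ℝ) := by
    have h := Nat.lt_floor_add_one (1 / ε)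
    have hk' : (1 : ℝ) ≤ k := by exact_mod_cast hk
    push_cast
    linarith
  obtain ⟨S, hlen, hS⟩ := hex (2 * k + (⌊c ^ (2 * k)⌋₊ + 1)) (by omega)
  have hcard : ((⌊c ^ (2 * k)⌋₊ + 1 : ℕ) : ℝ) ≤ Fintype.card α := by
    exact_mod_cast hS.lt_card hk hkε hlen
  calc c ^ (1 / ε) ≤ c ^ ((2 * k : ℕ) : ℝ) := Real.rpow_le_rpow_of_exponent_le hc.le hk2
    _ = c ^ (2 * k) := Real.rpow_natCast _ _
    _ ≤ (⌊c ^ (2 * k)⌋₊ + 1 : ℕ) := by exact_mod_cast (Nat.lt_floor_add_one (c ^ (2 * k))).le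
    _ ≤ Fintype.card α := hcard
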